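/- arXiv:1612.00599 — 3 statements merged into one kernel-verified Lean document; each statement's English description precedes it below -/
import Mathlib

section
/- For every vector x in R^d one has the identity x^T A x = x(1)^2 + sum_{i=1}^{d-1} (x(i) - x(i+1))^2 + (2/(sqrt(kappa)+1)) * x(d)^2; consequently 0 <= x^T A x <= 4 * ||x||^2 for all x in R^d. -/
open scoped BigOperators

/-- The hard tridiagonal matrix `A` from the paper: diagonal entries `2`
(except the last one, which is `(√κ+3)/(√κ+1)`), off-diagonal entries `-1`. -/
noncomputable def hardA (d : ℕ) (κ : ℝ) : Matrix (Fin d) (Fin d) ℝ :=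
  Matrix.of fun i j =>
    if i = j then (if (i : ℕ) = d - 1 then (Real.sqrt κ + 3) / (Real.sqrt κ + 1) else 2)
    else if (i : ℕ) + 1 = (j : ℕ) ∨ (j : ℕ) + 1 = (i : ℕ) then -1 else 0

/-- The quadratic form `x ↦ xᵀ M x`. -/
noncomputable def quadForm {d : ℕ} (M : Matrix (Fin d) (Fin d) ℝ)
    (x : EuclideanSpace ℝ (Fin d)) : ℝ :=
  ∑ i, ∑ j, M i j * x i * x j

/-- The entries of the second-difference matrix, indexed by natural numbers. -/
def secondDiff (i j : ℕ) : ℝ :=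
  if i = j then 2 else if i + 1 = j ∨ j + 1 = i then -1 else 0

theorem secondDiff_comm (i j : ℕ) : secondDiff i j = secondDiff j i := by
  grind [secondDiff]

theorem sum_secondDiff_succ (y : ℕ → ℝ) (n : ℕ) :
    ∑ i ∈ Finset.range (n + 1), secondDiff i (n + 1) * y i * y (n + 1) = -(y n * y (n + 1)) := by
  rw [Finset.sum_range_succ, Finset.sum_eq_zero]
  · simp [secondDiff]
  · intro i hi
    have h : secondDiff i (n + 1) = 0 := by grind [secondDiff]
    simp [h]

theorem sum_sum_secondDiff (y : ℕ → ℝ) (n : ℕ) :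
    ∑ i ∈ Finset.range (n + 1), ∑ j ∈ Finset.range (n + 1), secondDiff i j * y i * y j
      = y 0 ^ 2 + ∑ i ∈ Finset.range n, (y i - y (i + 1)) ^ 2 + y n ^ 2 := by
  induction n with
  | zero => simp [secondDiff]; ring
  | succ n ih =>
    have h_row : ∑ j ∈ Finset.range (n + 1), secondDiff (n + 1) j * y (n + 1) * y j
        = -(y n * y (n + 1)) := by
      rw [← sum_secondDiff_succ]
      refine Finset.sum_congr rfl fun j _ => ?_
      rw [secondDiff_comm]; ring
    have h_diag : secondDiff (n + 1) (n + 1) = 2 := by simp [secondDiff]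
    rw [Finset.sum_range_succ]
    simp_rw [Finset.sum_range_succ _ (n + 1)]
    rw [Finset.sum_add_distrib, ih, sum_secondDiff_succ, h_row, h_diag, Finset.sum_range_succ]
    ring

theorem hardA_apply (n : ℕ) (κ : ℝ) (i j : Fin (n + 1)) :
    hardA (n + 1) κ i j
      = secondDiff i j + if i = Fin.last n ∧ j = Fin.last n then
          (Real.sqrt κ + 3) / (Real.sqrt κ + 1) - 2 else 0 := by
  simp only [hardA, secondDiff, Matrix.of_apply, Fin.ext_iff, Fin.val_last, Nat.add_sub_cancel]
  grind

theorem quadForm_hardA (n : ℕ) (κ : ℝ) (x : EuclideanSpace ℝ (Fin (n + 1))) (y : ℕ → ℝ)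
    (hy : ∀ i : Fin (n + 1), x i = y i) :
    quadForm (hardA (n + 1) κ) x
      = y 0 ^ 2 + ∑ i ∈ Finset.range n, (y i - y (i + 1)) ^ 2
        + 2 / (Real.sqrt κ + 1) * y n ^ 2 := by
  have h_corner : ∑ i : Fin (n + 1), ∑ j : Fin (n + 1),
      (if i = Fin.last n ∧ j = Fin.last n then
        (Real.sqrt κ + 3) / (Real.sqrt κ + 1) - 2 else 0) * y i * y j
      = ((Real.sqrt κ + 3) / (Real.sqrt κ + 1) - 2) * y n ^ 2 := by
    simp [ite_and, ite_mul]
    ring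
  have h_main := sum_sum_secondDiff y n
  simp only [Finset.sum_range (n := n + 1)] at h_main
  simp only [quadForm, hardA_apply, hy, add_mul, Finset.sum_add_distrib]
  rw [h_corner, h_main]
  have : Real.sqrt κ + 1 ≠ 0 := by positivity
  field_simp
  ring

theorem sum_sq_sub_le (y : ℕ → ℝ) (n : ℕ) :
    y 0 ^ 2 + ∑ i ∈ Finset.range n, (y i - y (i + 1)) ^ 2 + y n ^ 2
      ≤ 4 * ∑ i ∈ Finset.range (n + 1), y i ^ 2 := by
  have h : ∑ i ∈ Finset.range n, (y i - y (i + 1)) ^ 2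
      ≤ 2 * ∑ i ∈ Finset.range n, y i ^ 2 + 2 * ∑ i ∈ Finset.range n, y (i + 1) ^ 2 := by
    rw [Finset.mul_sum, Finset.mul_sum, ← Finset.sum_add_distrib]
    exact Finset.sum_le_sum fun i _ => by nlinarith [sq_nonneg (y i + y (i + 1))]
  have h_first := Finset.sum_range_succ' (fun i => y i ^ 2) n
  have h_last := Finset.sum_range_succ (fun i => y i ^ 2) n
  nlinarith [sq_nonneg (y 0), sq_nonneg (y n)]

theorem stmt0 (d : ℕ) (hd : 2 ≤ d) (κ : ℝ) (hκ : 1 < κ)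
    (x : EuclideanSpace ℝ (Fin d)) :
    quadForm (hardA d κ) x
        = x ⟨0, by omega⟩ ^ 2
          + (∑ i : Fin (d - 1), (x ⟨(i : ℕ), by omega⟩ - x ⟨(i : ℕ) + 1, by omega⟩) ^ 2)
          + 2 / (Real.sqrt κ + 1) * x ⟨d - 1, by omega⟩ ^ 2
      ∧ 0 ≤ quadForm (hardA d κ) x
      ∧ quadForm (hardA d κ) x ≤ 4 * ‖x‖ ^ 2 := by
  obtain ⟨n, rfl⟩ : ∃ n, d = n + 1 := ⟨d - 1, by omega⟩
  let y : ℕ → ℝ := fun i => if h : i < n + 1 then x ⟨i, h⟩ else 0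
  have hy (i : ℕ) (h : i < n + 1) : x ⟨i, h⟩ = y i := by
    simp only [y, dif_pos h]
  have h_form := quadForm_hardA n κ x y fun i => hy i i.isLt
  have h_norm : ‖x‖ ^ 2 = ∑ i ∈ Finset.range (n + 1), y i ^ 2 := by
    rw [EuclideanSpace.real_norm_sq_eq, Finset.sum_range]
    exact Finset.sum_congr rfl fun i _ => by rw [← hy i i.isLt]
  have h_coef : 2 / (Real.sqrt κ + 1) ≤ 1 := by
    have : 1 ≤ Real.sqrt κ := Real.one_le_sqrt.mpr hκ.le
    rw [div_le_one (by positivity)]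
    linarith
  refine ⟨?_, ?_, ?_⟩
  · simp only [h_form, hy, Finset.sum_range, Nat.add_sub_cancel]
    rfl
  · rw [h_form]
    positivity
  · rw [h_form, h_norm]
    nlinarith [sum_sq_sub_le y n, mul_le_mul_of_nonneg_right h_coef (sq_nonneg (y n))]
end

section
/- The function f is lambda-strongly convex and (lambda*kappa)-smooth: for all x, y in R^d, (lambda/2)*||y - x||^2 <= f(y) - f(x) - <grad f(x), y - x> <= (lambda*kappa/2)*||y - x||^2. -/
open scoped BigOperators InnerProductSpace

/-- The first coordinate `w(1)` of a vector. -/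
noncomputable def coord0 {d : ℕ} (w : EuclideanSpace ℝ (Fin d)) : ℝ :=
  if h : 0 < d then w ⟨0, h⟩ else 0

/-- The hard instance `f(w) = (λ(κ-1)/4)((1/2) wᵀAw - w(1)) + (λ/2)‖w‖²`. -/
noncomputable def hardF (d : ℕ) (lam κ : ℝ) (w : EuclideanSpace ℝ (Fin d)) : ℝ :=
  lam * (κ - 1) / 4 * ((1 / 2) * quadForm (hardA d κ) w - coord0 w) + lam / 2 * ‖w‖ ^ 2

/-- A function with an exact quadratically bounded first-order expansion at `x` has the linear
part of that expansion as its gradient. -/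
theorem inner_gradient_of_expansion {E : Type*} [NormedAddCommGroup E] [InnerProductSpace ℝ E]
    [CompleteSpace E] {f : E → ℝ} {x : E} (L : E →L[ℝ] ℝ) (C : ℝ)
    (h : ∀ v, |f (x + v) - f x - L v| ≤ C * ‖v‖ ^ 2) (v : E) :
    ⟪gradient f x, v⟫_ℝ = L v := by
  have hf : HasFDerivAt f L x := by
    rw [hasFDerivAt_iff_isLittleO_nhds_zero]
    refine Asymptotics.IsBigO.trans_isLittleO (g := fun v : E => ‖v‖ ^ 2) ?_ ?_
    · refine Asymptotics.IsBigO.of_bound C (Filter.Eventually.of_forall fun v => ?_)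
      simpa using h v
    · exact Asymptotics.isLittleO_norm_pow_id one_lt_two
  rw [gradient, hf.fderiv, InnerProductSpace.toDual_symm_apply]

theorem coord0_add {d : ℕ} (v w : EuclideanSpace ℝ (Fin d)) :
    coord0 (v + w) = coord0 v + coord0 w := by
  unfold coord0; split_ifs <;> simp

theorem coord0_smul {d : ℕ} (r : ℝ) (v : EuclideanSpace ℝ (Fin d)) :
    coord0 (r • v) = r * coord0 v := by
  unfold coord0; split_ifs <;> simp

theorem quadForm_add {d : ℕ} (M : Matrix (Fin d) (Fin d) ℝ) (x v : EuclideanSpace ℝ (Fin d)) :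
    quadForm M (x + v)
      = quadForm M x + ∑ i, ∑ j, M i j * (x i * v j + v i * x j) + quadForm M v := by
  simp only [quadForm, ← Finset.sum_add_distrib, PiLp.add_apply]
  exact Finset.sum_congr rfl fun i _ => Finset.sum_congr rfl fun j _ => by ring

/-- The differential of `hardF` at `x`. -/
noncomputable def hardFDeriv (d : ℕ) (lam κ : ℝ) (x : EuclideanSpace ℝ (Fin d)) :
    EuclideanSpace ℝ (Fin d) →ₗ[ℝ] ℝ where
  toFun v := lam * (κ - 1) / 4 *
    ((1 / 2) * ∑ i, ∑ j, hardA d κ i j * (x i * v j + v i * x j) - coord0 v) + lam * ⟪x, v⟫_ℝ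
  map_add' v w := by
    have h : ∑ i, ∑ j, hardA d κ i j * (x i * (v + w) j + (v + w) i * x j)
        = ∑ i, ∑ j, hardA d κ i j * (x i * v j + v i * x j)
          + ∑ i, ∑ j, hardA d κ i j * (x i * w j + w i * x j) := by
      simp only [← Finset.sum_add_distrib, PiLp.add_apply]
      exact Finset.sum_congr rfl fun i _ => Finset.sum_congr rfl fun j _ => by ring
    rw [h, coord0_add, inner_add_right]
    ring
  map_smul' r v := by
    have h : ∑ i, ∑ j, hardA d κ i j * (x i * (r • v) j + (r • v) i * x j)
        = r * ∑ i, ∑ j, hardA d κ i j * (x i * v j + v i * x j) := by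
      simp only [Finset.mul_sum, PiLp.smul_apply, smul_eq_mul]
      exact Finset.sum_congr rfl fun i _ => Finset.sum_congr rfl fun j _ => by ring
    rw [h, coord0_smul, inner_smul_right, RingHom.id_apply, smul_eq_mul]
    ring

theorem hardF_add (d : ℕ) (lam κ : ℝ) (x v : EuclideanSpace ℝ (Fin d)) :
    hardF d lam κ (x + v) - hardF d lam κ x - hardFDeriv d lam κ x v
      = lam * (κ - 1) / 8 * quadForm (hardA d κ) v + lam / 2 * ‖v‖ ^ 2 := by
  simp only [hardF, hardFDeriv, LinearMap.coe_mk, AddHom.coe_mk, quadForm_add, coord0_add,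
    norm_add_sq_real]
  ring

theorem quadForm_hardA_succ (n : ℕ) (κ : ℝ) (v : EuclideanSpace ℝ (Fin (n + 1))) :
    quadForm (hardA (n + 1) κ) v
      = 2 * ∑ i : Fin n, v i.castSucc ^ 2
        + (Real.sqrt κ + 3) / (Real.sqrt κ + 1) * v (Fin.last n) ^ 2
        - 2 * ∑ i : Fin n, v i.castSucc * v i.succ := by
  have hsplit : ∀ i j : Fin (n + 1), hardA (n + 1) κ i j * v i * v j
      = (if i = j then (if (i : ℕ) = n then (Real.sqrt κ + 3) / (Real.sqrt κ + 1) else 2)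
          * v i * v j else 0)
        - (if (i : ℕ) + 1 = j then v i * v j else 0)
        - (if (j : ℕ) + 1 = i then v j * v i else 0) := by
    intro i j
    simp only [hardA, Matrix.of_apply, Nat.add_sub_cancel, Fin.ext_iff]
    split_ifs <;> first | omega | ring
  have hoff : ∑ i : Fin (n + 1), ∑ j : Fin (n + 1), (if (i : ℕ) + 1 = j then v i * v j else 0)
      = ∑ i : Fin n, v i.castSucc * v i.succ := by
    rw [Fin.sum_univ_castSucc, Finset.sum_eq_zero (s := Finset.univ) (f := fun j : Fin (n + 1) =>
      if ((Fin.last n : Fin (n + 1)) : ℕ) + 1 = j then v (Fin.last n) * v j else 0), add_zero]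
    · refine Finset.sum_congr rfl fun i _ => ?_
      rw [Fin.sum_univ_succ]
      simp [← Fin.ext_iff]
    · intro j _
      have := j.isLt
      rw [if_neg]
      simp only [Fin.val_last]
      omega
  have hdiag : ∑ i : Fin (n + 1),
      (if (i : ℕ) = n then (Real.sqrt κ + 3) / (Real.sqrt κ + 1) else 2) * v i * v i
      = 2 * ∑ i : Fin n, v i.castSucc ^ 2
        + (Real.sqrt κ + 3) / (Real.sqrt κ + 1) * v (Fin.last n) ^ 2 := by
    rw [Fin.sum_univ_castSucc, Finset.mul_sum]
    congr 1
    · refine Finset.sum_congr rfl fun i _ => ?_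
      rw [if_neg (by simpa using i.isLt.ne)]
      ring
    · simp only [Fin.val_last, if_true]
      ring
  simp only [quadForm, hsplit, Finset.sum_sub_distrib]
  rw [hoff, Finset.sum_comm (f := fun i j : Fin (n + 1) =>
    if (j : ℕ) + 1 = i then v j * v i else 0), hoff]
  simp only [Finset.sum_ite_eq, Finset.mem_univ, if_true, hdiag]
  ring

theorem quadForm_hardA_bounds {d : ℕ} (hd : d ≠ 0) (κ : ℝ) (v : EuclideanSpace ℝ (Fin d)) :
    0 ≤ quadForm (hardA d κ) v ∧ quadForm (hardA d κ) v ≤ 4 * ‖v‖ ^ 2 := by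
  obtain ⟨n, rfl⟩ := Nat.exists_eq_succ_of_ne_zero hd
  have hs := Real.sqrt_nonneg κ
  have hlow : 1 ≤ (Real.sqrt κ + 3) / (Real.sqrt κ + 1) := by
    rw [le_div_iff₀ (by positivity)]; linarith
  have hupp : (Real.sqrt κ + 3) / (Real.sqrt κ + 1) ≤ 3 := by
    rw [div_le_iff₀ (by positivity)]; linarith
  have hlast := sq_nonneg (v (Fin.last n))
  have hzero := sq_nonneg (v 0)
  have hlow' := mul_le_mul_of_nonneg_right hlow hlast
  have hupp' := mul_le_mul_of_nonneg_right hupp hlast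
  have hnorm := EuclideanSpace.real_norm_sq_eq v
  have hcast := Fin.sum_univ_castSucc fun i => v i ^ 2
  have hsucc := Fin.sum_univ_succ fun i => v i ^ 2
  have hsub : 0 ≤ ∑ i : Fin n, (v i.castSucc - v i.succ) ^ 2 :=
    Finset.sum_nonneg fun i _ => sq_nonneg _
  have hadd : 0 ≤ ∑ i : Fin n, (v i.castSucc + v i.succ) ^ 2 :=
    Finset.sum_nonneg fun i _ => sq_nonneg _
  simp only [sub_sq, add_sq, Finset.sum_add_distrib, Finset.sum_sub_distrib, mul_assoc,
    ← Finset.mul_sum] at hsub hadd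
  rw [quadForm_hardA_succ]
  constructor <;> linarith

theorem stmt1 (d : ℕ) (hd : 2 ≤ d) (lam κ : ℝ) (hlam : 0 < lam) (hκ : 1 < κ)
    (x y : EuclideanSpace ℝ (Fin d)) :
    lam / 2 * ‖y - x‖ ^ 2
        ≤ hardF d lam κ y - hardF d lam κ x - ⟪gradient (hardF d lam κ) x, y - x⟫_ℝ
      ∧ hardF d lam κ y - hardF d lam κ x - ⟪gradient (hardF d lam κ) x, y - x⟫_ℝ
        ≤ lam * κ / 2 * ‖y - x‖ ^ 2 := by
  have hc : 0 ≤ lam * (κ - 1) / 8 := by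
    have := mul_pos hlam (sub_pos.2 hκ)
    positivity
  have hgrad := inner_gradient_of_expansion (f := hardF d lam κ) (x := x)
    (hardFDeriv d lam κ x).toContinuousLinearMap (lam * κ / 2) (fun v => by
      obtain ⟨h₀, h₁⟩ := quadForm_hardA_bounds (by omega : d ≠ 0) κ v
      rw [LinearMap.coe_toContinuousLinearMap', hardF_add, abs_of_nonneg (by positivity)]
      linarith [mul_le_mul_of_nonneg_left h₁ hc]) (y - x)
  have hexp := hardF_add d lam κ x (y - x)
  rw [add_sub_cancel] at hexp
  rw [hgrad, LinearMap.coe_toContinuousLinearMap', hexp]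
  obtain ⟨h₀, h₁⟩ := quadForm_hardA_bounds (by omega : d ≠ 0) κ (y - x)
  constructor
  · linarith [mul_nonneg hc h₀]
  · linarith [mul_le_mul_of_nonneg_left h₁ hc]
end

section
/- For every 0 <= K <= d-1 and every u in E_{K,d}, the gradient of f at u belongs to E_{K+1,d}. -/
open scoped BigOperators

/-- `E_{t,d}`: vectors of `ℝ^d` whose coordinates `t+1, …, d` (1-based) vanish. -/
def Eset (d t : ℕ) : Set (EuclideanSpace ℝ (Fin d)) :=
  {x | ∀ i : Fin d, t ≤ (i : ℕ) → x i = 0}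

theorem differentiable_hardF (d : ℕ) (lam κ : ℝ) : Differentiable ℝ (hardF d lam κ) := by
  have hcoord : Differentiable ℝ (coord0 (d := d)) := by
    unfold coord0
    split_ifs <;> fun_prop
  have hquad : Differentiable ℝ (quadForm (hardA d κ)) := by
    unfold quadForm
    fun_prop
  have hnorm : Differentiable ℝ fun w : EuclideanSpace ℝ (Fin d) => ‖w‖ ^ 2 :=
    differentiable_id.norm_sq ℝ
  unfold hardF
  fun_prop

theorem gradient_apply_eq_deriv {d : ℕ} {f : EuclideanSpace ℝ (Fin d) → ℝ}
    {u : EuclideanSpace ℝ (Fin d)} (hf : DifferentiableAt ℝ f u) (k : Fin d) :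
    gradient f u k = deriv (fun t : ℝ => f (u + t • EuclideanSpace.single k 1)) 0 := by
  have h : inner ℝ (gradient f u) (EuclideanSpace.single k 1) =
      fderiv ℝ f u (EuclideanSpace.single k 1) := by
    simp [gradient]
  rw [EuclideanSpace.inner_single_right] at h
  simp only [one_mul, conj_trivial] at h
  rw [h, ← hf.lineDeriv_eq_fderiv, lineDeriv]

theorem hardA_eq_zero {d : ℕ} (κ : ℝ) {i j : Fin d}
    (h : (i : ℕ) + 1 < j ∨ (j : ℕ) + 1 < i) : hardA d κ i j = 0 := by
  have hij : i ≠ j := by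
    rintro rfl
    omega
  rw [hardA, Matrix.of_apply, if_neg hij, if_neg (by omega)]

/-- Moving in a coordinate direction that does not interact with the support of `u`
changes the quadratic form only at second order. -/
theorem quadForm_add_smul_single {d : ℕ} {M : Matrix (Fin d) (Fin d) ℝ}
    {u : EuclideanSpace ℝ (Fin d)} {k : Fin d} (hrow : ∀ j, M k j * u j = 0)
    (hcol : ∀ j, M j k * u j = 0) (t : ℝ) :
    quadForm M (u + t • EuclideanSpace.single k 1) = quadForm M u + M k k * t ^ 2 := by
  have hterm : ∀ i j, M i j * (u + t • EuclideanSpace.single k (1 : ℝ)) i *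
      (u + t • EuclideanSpace.single k (1 : ℝ)) j =
      M i j * u i * u j + if i = k then (if j = k then M k k * t ^ 2 else 0) else 0 := by
    intro i j
    have h1 := hrow j
    have h2 := hcol i
    by_cases hi : i = k <;> by_cases hj : j = k
    · subst hi hj
      simp
      linear_combination 2 * t * h1
    · subst hi
      rcases mul_eq_zero.1 h1 with h | h <;> simp [hj, h]
    · subst hj
      rcases mul_eq_zero.1 h2 with h | h <;> simp [hi, h]
    · simp [hi, hj]
  simp only [quadForm, hterm, Finset.sum_add_distrib]
  simp

theorem hardF_add_smul_single {d : ℕ} (lam κ : ℝ) {K : ℕ} {u : EuclideanSpace ℝ (Fin d)}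
    (hu : u ∈ Eset d K) {k : Fin d} (hk : K + 1 ≤ (k : ℕ)) (t : ℝ) :
    hardF d lam κ (u + t • EuclideanSpace.single k 1) =
      hardF d lam κ u + (lam * (κ - 1) / 8 * hardA d κ k k + lam / 2) * t ^ 2 := by
  have hrow : ∀ j, hardA d κ k j * u j = 0 := by
    intro j
    by_cases hj : K ≤ (j : ℕ)
    · rw [hu j hj, mul_zero]
    · rw [hardA_eq_zero κ (Or.inr (by omega)), zero_mul]
  have hcol : ∀ j, hardA d κ j k * u j = 0 := by
    intro j
    by_cases hj : K ≤ (j : ℕ)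
    · rw [hu j hj, mul_zero]
    · rw [hardA_eq_zero κ (Or.inl (by omega)), zero_mul]
  have hcoord : coord0 (u + t • EuclideanSpace.single k 1) = coord0 u := by
    have hd : 0 < d := k.pos
    have hne : (⟨0, hd⟩ : Fin d) ≠ k := by
      intro h
      have := congrArg Fin.val h
      simp only at this
      omega
    simp [coord0, hd, hne]
  have hnorm : ‖u + t • EuclideanSpace.single k (1 : ℝ)‖ ^ 2 = ‖u‖ ^ 2 + t ^ 2 := by
    rw [norm_add_sq_real, inner_smul_right, EuclideanSpace.inner_single_right,
      hu k (by omega), norm_smul]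
    simp
  rw [hardF, hardF, quadForm_add_smul_single hrow hcol, hcoord, hnorm]
  ring

theorem stmt4 (d : ℕ) (hd : 2 ≤ d) (lam κ : ℝ) (hlam : 0 < lam) (hκ : 1 < κ)
    (K : ℕ) (hK : K ≤ d - 1) (u : EuclideanSpace ℝ (Fin d)) (hu : u ∈ Eset d K) :
    gradient (hardF d lam κ) u ∈ Eset d (K + 1) := by
  intro k hk
  rw [gradient_apply_eq_deriv (differentiable_hardF d lam κ u)]
  simp [hardF_add_smul_single lam κ hu hk]
end
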